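/- arXiv:2601.16972 — 2 statements merged into one kernel-verified Lean document; each statement's English description precedes it below -/
import Mathlib

section
/- For all sufficiently large positive integers n, if k denotes the integer k = ⌈0.6 · √(log n / log log n)⌉, then f(k·n, k·n) > (2 + 1/100) · k² · n. (Here log denotes the natural logarithm.) -/
open Real

/-- `f n m` is the least nonnegative integer `L` such that the interval `(m, m + L]`
contains `n` distinct integers `a 1, ..., a n` with `i ∣ a i` for all `1 ≤ i ≤ n`. -/
noncomputable def f (n m : ℕ) : ℕ :=
  sInf {L : ℕ | ∃ a : ℕ → ℕ,
    (∀ i ∈ Finset.Icc 1 n, i ∣ a i) ∧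
    (∀ i ∈ Finset.Icc 1 n, m < a i ∧ a i ≤ m + L) ∧
    Set.InjOn a (Finset.Icc 1 n)}

/-- The number of prime factors of `r` lying in `G`, counted with multiplicity. -/
def omegaOn (G : Finset ℕ) (r : ℕ) : ℕ := ∑ p ∈ G, r.factorization p

lemma omegaOn_mul (G : Finset ℕ) {r s : ℕ} (hr : r ≠ 0) (hs : s ≠ 0) :
    omegaOn G (r * s) = omegaOn G r + omegaOn G s := by
  simp [omegaOn, Nat.factorization_mul hr hs, Finset.sum_add_distrib]

lemma omegaOn_prime (G : Finset ℕ) {p : ℕ} (hp : p.Prime) :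
    omegaOn G p = if p ∈ G then 1 else 0 := by
  simp [omegaOn, hp.factorization, Finsupp.single_apply]

lemma omegaOn_prime_mul (G : Finset ℕ) {p r : ℕ} (hp : p.Prime) (hr : r ≠ 0) :
    omegaOn G (p * r) = omegaOn G r + if p ∈ G then 1 else 0 := by
  rw [omegaOn_mul G hp.ne_zero hr, omegaOn_prime G hp, add_comm]

lemma prod_pow_factorization_dvd {G : Finset ℕ} (hG : ∀ p ∈ G, p.Prime) (r : ℕ) :
    ∏ p ∈ G, p ^ r.factorization p ∣ r := by
  refine Finset.prod_dvd_of_isRelPrime ?_ fun p _ => Nat.ordProj_dvd r p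
  intro p hp q hq hpq
  exact Nat.coprime_iff_isRelPrime.1 (((Nat.coprime_primes (hG p hp) (hG q hq)).2 hpq).pow _ _)

/-- If every prime of `G` is at least the square root of `c`, then `c ^ Ω_G(r) ≤ r ^ 2`. -/
lemma pow_omegaOn_le_sq {G : Finset ℕ} (hG : ∀ p ∈ G, p.Prime) {c : ℕ}
    (hc : ∀ p ∈ G, c ≤ p ^ 2) {r : ℕ} (hr : r ≠ 0) : c ^ omegaOn G r ≤ r ^ 2 := by
  calc c ^ omegaOn G r = ∏ p ∈ G, c ^ r.factorization p := by
        rw [omegaOn, Finset.prod_pow_eq_pow_sum]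
    _ ≤ ∏ p ∈ G, (p ^ 2) ^ r.factorization p :=
        Finset.prod_le_prod' fun p hp => Nat.pow_le_pow_left (hc p hp) _
    _ = (∏ p ∈ G, p ^ r.factorization p) ^ 2 := by
        rw [← Finset.prod_pow]; exact Finset.prod_congr rfl fun p _ => by ring
    _ ≤ r ^ 2 := Nat.pow_le_pow_left
        (Nat.le_of_dvd (Nat.pos_of_ne_zero hr) (prod_pow_factorization_dvd hG r)) _

lemma two_pow_omegaOn_le {G : Finset ℕ} (hG : ∀ p ∈ G, p.Prime) {r : ℕ} (hr : r ≠ 0) :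
    2 ^ omegaOn G r ≤ r := by
  calc 2 ^ omegaOn G r = ∏ p ∈ G, 2 ^ r.factorization p := by
        rw [omegaOn, Finset.prod_pow_eq_pow_sum]
    _ ≤ ∏ p ∈ G, p ^ r.factorization p :=
        Finset.prod_le_prod' fun p hp => Nat.pow_le_pow_left (hG p hp).two_le _
    _ ≤ r := Nat.le_of_dvd (Nat.pos_of_ne_zero hr) (prod_pow_factorization_dvd hG r)

lemma le_pow_omegaOn {G : Finset ℕ} {y : ℕ} (hy : ∀ p ∈ G, p ≤ y) {r : ℕ} (hr : r ≠ 0)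
    (hrG : ∀ p, p.Prime → p ∣ r → p ∈ G) : r ≤ y ^ omegaOn G r := by
  have hsub : r.primeFactors ⊆ G := fun p hp =>
    hrG p (Nat.prime_of_mem_primeFactors hp) (Nat.dvd_of_mem_primeFactors hp)
  calc r = ∏ p ∈ r.primeFactors, p ^ r.factorization p :=
        (Nat.prod_factorization_pow_eq_self hr).symm
    _ = ∏ p ∈ G, p ^ r.factorization p := by
        refine Finset.prod_subset hsub fun p _ hp => ?_
        rw [← Nat.support_factorization, Finsupp.notMem_support_iff] at hp
        rw [hp, pow_zero]
    _ ≤ ∏ p ∈ G, y ^ r.factorization p :=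
        Finset.prod_le_prod' fun p hp => Nat.pow_le_pow_left (hy p hp) _
    _ = y ^ omegaOn G r := by rw [omegaOn, Finset.prod_pow_eq_pow_sum]

/-- Raising the bound on the number of prime factors in `G` from `R` to `R + 1` multiplies the
size of a family that is otherwise insensitive to these primes by `1 + #G / (R + 1)`. -/
lemma succ_mul_card_eq {G : Finset ℕ} (hG : ∀ p ∈ G, p.Prime) {U : ℕ → Prop}
    (hU0 : ∀ r, U r → r ≠ 0) (hU : ∀ p ∈ G, ∀ r, U (p * r) ↔ U r) {R : ℕ} {A A' : Finset ℕ}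
    (hA : ∀ r, r ∈ A ↔ U r ∧ omegaOn G r ≤ R) (hA' : ∀ r, r ∈ A' ↔ U r ∧ omegaOn G r ≤ R + 1) :
    (R + 1) * A'.card = (R + 1 + G.card) * A.card := by
  have hsub : A ⊆ A' := fun r hr => (hA' r).2 ⟨((hA r).1 hr).1, ((hA r).1 hr).2.trans (by omega)⟩
  have h1 : ∀ p ∈ G, ∑ r ∈ A', r.factorization p = ∑ r ∈ A, (r.factorization p + 1) := by
    intro p hp
    have hpp := hG p hp
    have himg : A.image (p * ·) ⊆ A' := by
      intro s hs
      obtain ⟨r, hr, rfl⟩ := Finset.mem_image.1 hs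
      obtain ⟨hr1, hr2⟩ := (hA r).1 hr
      refine (hA' _).2 ⟨(hU p hp r).2 hr1, ?_⟩
      rw [omegaOn_prime_mul G hpp (hU0 r hr1), if_pos hp]; omega
    rw [← Finset.sum_subset himg, Finset.sum_image]
    · refine Finset.sum_congr rfl fun r hr => ?_
      rw [Nat.factorization_mul hpp.ne_zero (hU0 r ((hA r).1 hr).1), hpp.factorization]
      simp [add_comm]
    · intro a _ b _ hab
      exact Nat.eq_of_mul_eq_mul_left hpp.pos hab
    · intro s hs hsn
      refine Nat.factorization_eq_zero_of_not_dvd fun hd => hsn ?_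
      obtain ⟨r, rfl⟩ := hd
      obtain ⟨hr1, hr2⟩ := (hA' _).1 hs
      have hr1' := (hU p hp r).1 hr1
      rw [omegaOn_prime_mul G hpp (hU0 r hr1'), if_pos hp] at hr2
      exact Finset.mem_image_of_mem _ ((hA r).2 ⟨hr1', by omega⟩)
  have h2 : ∑ r ∈ A', omegaOn G r = ∑ r ∈ A, (omegaOn G r + G.card) := by
    simp only [omegaOn]
    rw [Finset.sum_comm, Finset.sum_congr rfl h1, Finset.sum_comm]
    simp [Finset.sum_add_distrib]
  have h3 : ∑ r ∈ A', (R + 1 - omegaOn G r) = ∑ r ∈ A, (R + 1 - omegaOn G r) := by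
    refine (Finset.sum_subset hsub fun r hr hrn => ?_).symm
    have := (hA' r).1 hr
    by_contra h
    exact hrn ((hA r).2 ⟨this.1, by omega⟩)
  calc (R + 1) * A'.card = ∑ r ∈ A', (omegaOn G r + (R + 1 - omegaOn G r)) := by
        rw [mul_comm, ← smul_eq_mul, ← Finset.sum_const]
        refine Finset.sum_congr rfl fun r hr => ?_
        have := ((hA' r).1 hr).2
        omega
    _ = ∑ r ∈ A, (omegaOn G r + G.card + (R + 1 - omegaOn G r)) := by
        rw [Finset.sum_add_distrib, h2, h3, ← Finset.sum_add_distrib]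
    _ = (R + 1 + G.card) * A.card := by
        rw [mul_comm, ← smul_eq_mul, ← Finset.sum_const]
        refine Finset.sum_congr rfl fun r hr => ?_
        have := ((hA r).1 hr).2
        omega

lemma omegaOn_union_le (G H : Finset ℕ) (r : ℕ) :
    omegaOn (G ∪ H) r ≤ omegaOn G r + omegaOn H r := by
  unfold omegaOn
  rw [← Finset.sum_union_inter]
  exact Nat.le_add_right _ _

/-- The positive integers composed of primes from `G₀ ∪ G₁ ∪ G₂`, with at most `cᵢ` prime factors
from `Gᵢ` counted with multiplicity. -/
def boundedOmega (G₀ G₁ G₂ : Finset ℕ) (c₀ c₁ c₂ : ℕ) : Finset ℕ :=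
  (Finset.range (((G₀ ∪ G₁ ∪ G₂).sup id + 1) ^ (c₀ + c₁ + c₂) + 1)).filter fun r =>
    r ≠ 0 ∧ r.primeFactors ⊆ G₀ ∪ G₁ ∪ G₂ ∧
      omegaOn G₀ r ≤ c₀ ∧ omegaOn G₁ r ≤ c₁ ∧ omegaOn G₂ r ≤ c₂

section
variable {G₀ G₁ G₂ : Finset ℕ}

lemma le_pow_of_omegaOn_le {y r c₀ c₁ c₂ : ℕ} (hy0 : 0 < y) (hy : ∀ p ∈ G₀ ∪ G₁ ∪ G₂, p ≤ y)
    (hr : r ≠ 0) (hrG : r.primeFactors ⊆ G₀ ∪ G₁ ∪ G₂) (h₀ : omegaOn G₀ r ≤ c₀)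
    (h₁ : omegaOn G₁ r ≤ c₁) (h₂ : omegaOn G₂ r ≤ c₂) : r ≤ y ^ (c₀ + c₁ + c₂) := by
  have h1 := le_pow_omegaOn hy hr fun p hp hd => hrG (Nat.mem_primeFactors.2 ⟨hp, hd, hr⟩)
  have h2 := omegaOn_union_le (G₀ ∪ G₁) G₂ r
  have h3 := omegaOn_union_le G₀ G₁ r
  exact h1.trans (Nat.pow_le_pow_right hy0 (by omega))

lemma mem_boundedOmega {c₀ c₁ c₂ r : ℕ} : r ∈ boundedOmega G₀ G₁ G₂ c₀ c₁ c₂ ↔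
    r ≠ 0 ∧ r.primeFactors ⊆ G₀ ∪ G₁ ∪ G₂ ∧
      omegaOn G₀ r ≤ c₀ ∧ omegaOn G₁ r ≤ c₁ ∧ omegaOn G₂ r ≤ c₂ := by
  rw [boundedOmega, Finset.mem_filter, Finset.mem_range, Nat.lt_succ_iff]
  refine ⟨fun h => h.2, fun h => ⟨?_, h⟩⟩
  obtain ⟨hr, hrG, h₀, h₁, h₂⟩ := h
  refine le_pow_of_omegaOn_le (Nat.succ_pos _) (fun p hp => ?_) hr hrG h₀ h₁ h₂
  exact (Finset.le_sup (f := id) hp).trans (Nat.le_succ _)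

lemma boundedOmega_mono {c₀ c₁ c₂ d₀ d₁ d₂ : ℕ} (h₀ : c₀ ≤ d₀) (h₁ : c₁ ≤ d₁) (h₂ : c₂ ≤ d₂) :
    boundedOmega G₀ G₁ G₂ c₀ c₁ c₂ ⊆ boundedOmega G₀ G₁ G₂ d₀ d₁ d₂ := by
  intro r
  simp only [mem_boundedOmega]
  rintro ⟨h1, h2, h3, h4, h5⟩
  exact ⟨h1, h2, h3.trans h₀, h4.trans h₁, h5.trans h₂⟩

lemma boundedOmega_rotate (c₀ c₁ c₂ : ℕ) :
    boundedOmega G₀ G₁ G₂ c₀ c₁ c₂ = boundedOmega G₁ G₂ G₀ c₁ c₂ c₀ := by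
  ext r
  have : G₀ ∪ G₁ ∪ G₂ = G₁ ∪ G₂ ∪ G₀ := by rw [Finset.union_assoc, Finset.union_comm]
  simp only [mem_boundedOmega, this]
  tauto

lemma succ_mul_card_boundedOmega (hG : ∀ p ∈ G₀, p.Prime) (h₁ : Disjoint G₀ G₁)
    (h₂ : Disjoint G₀ G₂) (R c₁ c₂ : ℕ) :
    (R + 1) * (boundedOmega G₀ G₁ G₂ (R + 1) c₁ c₂).card =
      (R + 1 + G₀.card) * (boundedOmega G₀ G₁ G₂ R c₁ c₂).card := by
  refine succ_mul_card_eq hG (U := fun r => r ≠ 0 ∧ r.primeFactors ⊆ G₀ ∪ G₁ ∪ G₂ ∧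
    omegaOn G₁ r ≤ c₁ ∧ omegaOn G₂ r ≤ c₂) (fun r h => h.1) ?_ ?_ ?_
  · intro p hp r
    have hpp := hG p hp
    rcases eq_or_ne r 0 with rfl | hr
    · simp
    have hsub : insert p r.primeFactors ⊆ G₀ ∪ G₁ ∪ G₂ ↔ r.primeFactors ⊆ G₀ ∪ G₁ ∪ G₂ := by
      rw [Finset.insert_subset_iff]
      simp [hp]
    have hpf : (p * r).primeFactors = insert p r.primeFactors := by
      rw [Nat.primeFactors_mul hpp.ne_zero hr, hpp.primeFactors, Finset.insert_eq]
    rw [omegaOn_prime_mul _ hpp hr, omegaOn_prime_mul _ hpp hr,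
      if_neg (Finset.disjoint_left.1 h₁ hp), if_neg (Finset.disjoint_left.1 h₂ hp), hpf, hsub]
    simp [hr, hpp.ne_zero]
  · intro r
    rw [mem_boundedOmega]
    tauto
  · intro r
    rw [mem_boundedOmega]
    tauto

end

/-- A set contained in an interval `(M / c, 2 ^ δ * M / c]` meets each class of integers with the
same odd part at most `δ` times. -/
lemma card_le_mul_card_image_ordCompl {A : Finset ℕ} {M c δ : ℕ}
    (hA : ∀ a ∈ A, M < c * a ∧ c * a ≤ 2 ^ δ * M) :
    A.card ≤ δ * (A.image fun a => a / 2 ^ a.factorization 2).card := by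
  refine Finset.card_le_mul_card_image A δ fun r _ => ?_
  set F := A.filter fun a => a / 2 ^ a.factorization 2 = r
  rcases F.eq_empty_or_nonempty with h | h
  · simp [h]
  obtain ⟨a₀, ha₀, hmin⟩ := F.exists_min_image id h
  have hmem : ∀ a ∈ F, a ∈ A ∧ 2 ^ a.factorization 2 * r = a := by
    intro a ha
    obtain ⟨h1, h2⟩ := Finset.mem_filter.1 ha
    exact ⟨h1, by rw [← h2]; exact Nat.ordProj_mul_ordCompl_eq_self a 2⟩
  obtain ⟨hA₀, hr₀⟩ := hmem a₀ ha₀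
  have hpos : 0 < r := by
    rcases Nat.eq_zero_or_pos r with h0 | h0
    · have := (hA a₀ hA₀).1
      rw [← hr₀, h0] at this
      simp at this
    · exact h0
  have hmaps : ∀ a ∈ F, a.factorization 2 ∈
      Finset.Ico (a₀.factorization 2) (a₀.factorization 2 + δ) := by
    intro a ha
    obtain ⟨hAa, hra⟩ := hmem a ha
    have hc : 0 < c := by
      rcases Nat.eq_zero_or_pos c with h0 | h0
      · have := (hA a hAa).1
        rw [h0] at this
        omega
      · exact h0
    have hle : a₀ ≤ a := hmin a ha
    have hlt : c * a < c * (2 ^ δ * a₀) := by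
      calc c * a ≤ 2 ^ δ * M := (hA a hAa).2
        _ < 2 ^ δ * (c * a₀) := Nat.mul_lt_mul_of_pos_left (hA a₀ hA₀).1 (by positivity)
        _ = c * (2 ^ δ * a₀) := by ring
    have hlt' : a < 2 ^ δ * a₀ := Nat.lt_of_mul_lt_mul_left hlt
    rw [Finset.mem_Ico]
    constructor
    · rw [← hra, ← hr₀] at hle
      exact (Nat.pow_le_pow_iff_right (by norm_num)).1 (Nat.le_of_mul_le_mul_right hle hpos)
    · have h3 : 2 ^ a.factorization 2 * r < 2 ^ (a₀.factorization 2 + δ) * r := by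
        rw [hra, add_comm, pow_add, mul_assoc, hr₀]
        exact hlt'
      exact (Nat.pow_lt_pow_iff_right (by norm_num)).1 (Nat.lt_of_mul_lt_mul_right h3)
  have hinj : Set.InjOn (fun a : ℕ => a.factorization 2) F := by
    intro a ha b hb hab
    have h1 := (hmem a ha).2
    have h2 := (hmem b hb).2
    rw [← h1, ← h2, show a.factorization 2 = b.factorization 2 from hab]
  calc F.card ≤ (Finset.Ico (a₀.factorization 2) (a₀.factorization 2 + δ)).card :=
        Finset.card_le_card_of_injOn _ hmaps hinj
    _ = δ := by simp

lemma omegaOn_two_pow_mul {G : Finset ℕ} (hG : 2 ∉ G) {r : ℕ} (hr : r ≠ 0) (e : ℕ) :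
    omegaOn G (2 ^ e * r) = omegaOn G r := by
  induction e with
  | zero => simp
  | succ e ih =>
    rw [pow_succ', mul_assoc, omegaOn_prime_mul G Nat.prime_two (by positivity), if_neg hG, ih,
      add_zero]

lemma omegaOn_ordCompl {G : Finset ℕ} (hG : 2 ∉ G) {a : ℕ} (ha : a ≠ 0) :
    omegaOn G (a / 2 ^ a.factorization 2) = omegaOn G a := by
  conv_rhs => rw [← Nat.ordProj_mul_ordCompl_eq_self a 2]
  exact (omegaOn_two_pow_mul hG (Nat.ordCompl_pos 2 ha).ne' _).symm

section
variable {G₀ G₁ G₂ : Finset ℕ}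

/-- Every `r ≤ N / 2 ^ (β + 1)` has `β + 1` consecutive multiples `2 ^ e * r` in
`(N / 2 ^ (β + 1), N]`. -/
lemma exists_dyadic_window {N r β : ℕ} (hr : r ≠ 0) (hrN : 2 ^ (β + 1) * r ≤ N) :
    ∃ e, N < 2 ^ (β + 1) * (2 ^ e * r) ∧ 2 ^ (e + β) * r ≤ N := by
  have hex : ∃ e, N < 2 ^ (β + 1) * (2 ^ e * r) := by
    refine ⟨N, ?_⟩
    calc N < 2 ^ N := Nat.lt_two_pow_self
      _ ≤ 2 ^ (β + 1) * (2 ^ N * r) := by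
        have h1 : 1 ≤ 2 ^ (β + 1) := Nat.one_le_two_pow
        have h2 : 1 ≤ r := Nat.pos_of_ne_zero hr
        nlinarith [Nat.mul_le_mul h1 (Nat.mul_le_mul_left (2 ^ N) h2)]
  classical
  refine ⟨Nat.find hex, Nat.find_spec hex, ?_⟩
  rcases h : Nat.find hex with _ | e
  · have := Nat.find_spec hex
    rw [h, pow_zero, one_mul] at this
    omega
  · have hmin : ¬ N < 2 ^ (β + 1) * (2 ^ e * r) := Nat.find_min hex (by omega)
    calc 2 ^ (e + 1 + β) * r = 2 ^ (β + 1) * (2 ^ e * r) := by ring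
      _ ≤ N := not_lt.1 hmin

/-- The cofactors `j` which occur in the multiples under consideration have few prime factors. -/
lemma omegaOn_cofactor_le {y j : ℕ} (hG : ∀ p ∈ G₁ ∪ G₂, p.Prime) (hd : Disjoint G₁ G₂)
    (hy : ∀ p ∈ G₁ ∪ G₂, y ≤ p ^ 2) (hj : j ≠ 0) (hjy : j < y) :
    omegaOn G₁ j + omegaOn G₂ j ≤ 1 := by
  have h1 := pow_omegaOn_le_sq hG hy hj
  have h2 : y ^ omegaOn (G₁ ∪ G₂) j < y ^ 2 := h1.trans_lt (Nat.pow_lt_pow_left hjy (by norm_num))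
  have h3 : omegaOn (G₁ ∪ G₂) j < 2 := (Nat.pow_lt_pow_iff_right (by omega)).1 h2
  rw [omegaOn, Finset.sum_union hd] at h3
  exact Nat.lt_succ_iff.1 h3

lemma mul_card_boundedOmega_le {β δ N R y : ℕ} {a : ℕ → ℕ} (hy : y = 2 ^ (2 * β + 1))
    (hG : ∀ p ∈ G₀ ∪ G₁ ∪ G₂, p.Prime ∧ p ≠ 2 ∧ p ≤ y)
    (hcover : ∀ p, p.Prime → p ≠ 2 → p < y → p ∈ G₀ ∪ G₁ ∪ G₂)
    (hd : Disjoint G₁ G₂) (h12 : ∀ p ∈ G₁ ∪ G₂, y ≤ p ^ 2) (h2 : ∀ p ∈ G₂, y ≤ 2 ^ δ * p)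
    (hN : 2 ^ (β + 1) * y ^ (3 * R) ≤ N) (ha_dvd : ∀ i ∈ Finset.Icc 1 N, i ∣ a i)
    (ha_mem : ∀ i ∈ Finset.Icc 1 N, N < a i ∧ a i ≤ 2 ^ β * N)
    (ha_inj : Set.InjOn a (Finset.Icc 1 N)) :
    (β + 1) * (boundedOmega G₀ G₁ G₂ R R R).card ≤
      β * (boundedOmega G₀ G₁ G₂ (R + (2 * β + 1)) (R + 1) R).card +
      δ * (boundedOmega G₀ G₁ G₂ (R + (2 * β + 1)) (R + 1) (R + 1) \
        boundedOmega G₀ G₁ G₂ (R + (2 * β + 1)) (R + 1) R).card := by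
  set E := boundedOmega G₀ G₁ G₂ R R R with hE
  set E₁ := boundedOmega G₀ G₁ G₂ (R + (2 * β + 1)) (R + 1) R with hE₁
  set E₂ := boundedOmega G₀ G₁ G₂ (R + (2 * β + 1)) (R + 1) (R + 1) with hE₂
  have h2G : 2 ∉ G₀ ∪ G₁ ∪ G₂ := fun h => (hG 2 h).2.1 rfl
  have h2G' : 2 ∉ G₀ ∧ 2 ∉ G₁ ∧ 2 ∉ G₂ := by simpa [not_or, and_assoc] using h2G
  have hy0 : 0 < y := by rw [hy]; positivity
  have hEodd : ∀ r ∈ E, ¬ 2 ∣ r := by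
    intro r hr hd2
    obtain ⟨hr0, hrs, -⟩ := mem_boundedOmega.1 hr
    exact h2G (hrs (Nat.mem_primeFactors.2 ⟨Nat.prime_two, hd2, hr0⟩))
  have hwin : ∀ r : ℕ, ∃ e, r ∈ E → N < 2 ^ (β + 1) * (2 ^ e * r) ∧ 2 ^ (e + β) * r ≤ N := by
    intro r
    by_cases hr : r ∈ E
    · obtain ⟨hr0, hrs, hr1, hr2, hr3⟩ := mem_boundedOmega.1 hr
      have hle := le_pow_of_omegaOn_le hy0 (fun p hp => (hG p hp).2.2) hr0 hrs hr1 hr2 hr3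
      rw [show R + R + R = 3 * R by ring] at hle
      obtain ⟨e, he⟩ := exists_dyadic_window hr0 ((Nat.mul_le_mul_left _ hle).trans hN)
      exact ⟨e, fun _ => he⟩
    · exact ⟨0, fun h => absurd h hr⟩
  choose e he using hwin
  set φ : ℕ × ℕ → ℕ := fun x => 2 ^ (e x.1 + x.2) * x.1 with hφ
  have hφ_mem : ∀ x ∈ E ×ˢ Finset.range (β + 1),
      φ x ∈ Finset.Icc 1 N ∧ N < 2 ^ (β + 1) * φ x := by
    rintro ⟨r, t⟩ hx
    obtain ⟨hr, ht⟩ : r ∈ E ∧ t ∈ Finset.range (β + 1) := Finset.mem_product.1 hx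
    have ht' : t < β + 1 := Finset.mem_range.1 ht
    have hr0 : r ≠ 0 := (mem_boundedOmega.1 hr).1
    obtain ⟨h1, h3⟩ := he r hr
    refine ⟨Finset.mem_Icc.2 ⟨Nat.pos_of_ne_zero (by simp [hφ, hr0]), ?_⟩, ?_⟩
    · refine le_trans ?_ h3
      refine Nat.mul_le_mul_right r (Nat.pow_le_pow_right (by norm_num) ?_)
      exact Nat.add_le_add_left (Nat.lt_succ_iff.1 ht') _
    · refine h1.trans_le (Nat.mul_le_mul_left _ (Nat.mul_le_mul_right r ?_))
      exact Nat.pow_le_pow_right (by norm_num) (Nat.le_add_right _ _)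
  have hφ_inj : Set.InjOn φ (E ×ˢ Finset.range (β + 1) : Finset (ℕ × ℕ)) := by
    rintro ⟨r, t⟩ hx ⟨r', t'⟩ hx' hxx
    have hr : r ∈ E := (Finset.mem_product.1 hx).1
    have hr' : r' ∈ E := (Finset.mem_product.1 hx').1
    have hr0 : r ≠ 0 := (mem_boundedOmega.1 hr).1
    have h1 := Nat.ordCompl_pow_mul_of_not_dvd (e r + t) Nat.prime_two (hEodd r hr)
    have h3 := Nat.ordCompl_pow_mul_of_not_dvd (e r' + t') Nat.prime_two (hEodd r' hr')
    have hxx' : 2 ^ (e r + t) * r = 2 ^ (e r' + t') * r' := hxx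
    rw [hxx', h3] at h1
    subst h1
    have := Nat.pow_right_injective le_rfl (Nat.eq_of_mul_eq_mul_right
      (Nat.pos_of_ne_zero hr0) hxx')
    simp only [Prod.mk.injEq, true_and]
    omega
  set Γ := (E ×ˢ Finset.range (β + 1)).image (a ∘ φ) with hΓ
  have hcard : Γ.card = (β + 1) * E.card := by
    rw [hΓ, Finset.card_image_of_injOn, Finset.card_product, Finset.card_range, mul_comm]
    exact ha_inj.comp hφ_inj fun x hx => (hφ_mem x hx).1
  have hΓ_mem : ∀ b ∈ Γ, N < b ∧ b ≤ 2 ^ β * N ∧ b / 2 ^ b.factorization 2 ∈ E₂ ∧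
      (b / 2 ^ b.factorization 2 ∉ E₁ → 2 ^ β * N < 2 ^ δ * b) := by
    intro b hb
    obtain ⟨⟨r, t⟩, hx, rfl⟩ := Finset.mem_image.1 hb
    have hr : r ∈ E := (Finset.mem_product.1 hx).1
    obtain ⟨hr0, hrs, hr1, hr2, hr3⟩ := mem_boundedOmega.1 hr
    obtain ⟨hi, hiN⟩ := hφ_mem _ hx
    simp only [Function.comp_apply]
    obtain ⟨hb1, hb2⟩ := ha_mem _ hi
    obtain ⟨j, hj⟩ := ha_dvd _ hi
    set i := φ (r, t) with hi_def
    have hi0 : 0 < i := (Finset.mem_Icc.1 hi).1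
    have hb0 : a i ≠ 0 := by omega
    have hj0 : j ≠ 0 := by rintro rfl; simp at hj; omega
    have hjy : j < y := by
      refine Nat.lt_of_mul_lt_mul_left (a := i) ?_
      calc i * j ≤ 2 ^ β * N := hj ▸ hb2
        _ < 2 ^ β * (2 ^ (β + 1) * i) := Nat.mul_lt_mul_of_pos_left hiN (by positivity)
        _ = i * y := by rw [hy]; ring
    have hj12 := omegaOn_cofactor_le (fun p hp => (hG p (by
      simp only [Finset.mem_union] at hp ⊢; tauto)).1) hd h12 hj0 hjy
    have hj_0 : omegaOn G₀ j ≤ 2 * β + 1 := by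
      have h1 := two_pow_omegaOn_le (G := G₀) (fun p hp => (hG p (by simp [hp])).1) hj0
      rw [hy] at hjy
      exact ((Nat.pow_lt_pow_iff_right (by norm_num)).1 (h1.trans_lt hjy)).le
    have homega : ∀ G : Finset ℕ, 2 ∉ G →
        omegaOn G (a i / 2 ^ (a i).factorization 2) = omegaOn G r + omegaOn G j := by
      intro G h2G
      rw [omegaOn_ordCompl h2G hb0, hj, omegaOn_mul G hi0.ne' hj0, hi_def,
        omegaOn_two_pow_mul h2G hr0]
    have hpf : (a i / 2 ^ (a i).factorization 2).primeFactors ⊆ G₀ ∪ G₁ ∪ G₂ := by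
      intro p hp
      have hpp := Nat.prime_of_mem_primeFactors hp
      have hpd := Nat.dvd_of_mem_primeFactors hp
      have hp2 : p ≠ 2 := by
        rintro rfl
        exact Nat.not_dvd_ordCompl Nat.prime_two hb0 hpd
      have hpa : p ∣ a i := hpd.trans (Nat.ordCompl_dvd _ _)
      rw [hj, hpp.dvd_mul] at hpa
      rcases hpa with hpa | hpa
      · rcases hpp.dvd_mul.1 hpa with h | h
        · exact absurd ((Nat.prime_dvd_prime_iff_eq hpp Nat.prime_two).1
            (hpp.dvd_of_dvd_pow h)) hp2
        · exact hrs (Nat.mem_primeFactors.2 ⟨hpp, h, hr0⟩)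
      · exact hcover p hpp hp2 ((Nat.le_of_dvd (Nat.pos_of_ne_zero hj0) hpa).trans_lt hjy)
    have hne : a i / 2 ^ (a i).factorization 2 ≠ 0 := (Nat.ordCompl_pos 2 hb0).ne'
    refine ⟨hb1, hb2, ?_, fun hnot => ?_⟩
    · rw [hE₂, mem_boundedOmega, homega _ h2G'.1, homega _ h2G'.2.1, homega _ h2G'.2.2]
      exact ⟨hne, hpf, by omega, by omega, by omega⟩
    · have hj2 : omegaOn G₂ j ≠ 0 := by
        intro h0
        apply hnot
        rw [hE₁, mem_boundedOmega, homega _ h2G'.1, homega _ h2G'.2.1, homega _ h2G'.2.2]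
        exact ⟨hne, hpf, by omega, by omega, by omega⟩
      obtain ⟨p, hp, hpj⟩ := Finset.exists_ne_zero_of_sum_ne_zero hj2
      have hpj' : p ∣ j := Nat.dvd_of_factorization_pos hpj
      have hple : p ≤ j := Nat.le_of_dvd (Nat.pos_of_ne_zero hj0) hpj'
      calc 2 ^ β * N < 2 ^ β * (2 ^ (β + 1) * i) :=
            Nat.mul_lt_mul_of_pos_left hiN (by positivity)
        _ = i * y := by rw [hy]; ring
        _ ≤ i * (2 ^ δ * p) := Nat.mul_le_mul_left _ (h2 p hp)
        _ ≤ i * (2 ^ δ * j) := Nat.mul_le_mul_left _ (Nat.mul_le_mul_left _ hple)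
        _ = 2 ^ δ * a i := by rw [hj]; ring
  set Γ₁ := Γ.filter fun b => b / 2 ^ b.factorization 2 ∈ E₁
  set Γ₂ := Γ.filter fun b => ¬ b / 2 ^ b.factorization 2 ∈ E₁
  have hΓ₁ : Γ₁.card ≤ β * E₁.card := by
    refine (card_le_mul_card_image_ordCompl (M := N) (c := 1) (δ := β) fun b hb => ?_).trans
      (Nat.mul_le_mul_left _ (Finset.card_le_card fun s hs => ?_))
    · obtain ⟨h1, h3, -⟩ := hΓ_mem b (Finset.mem_filter.1 hb).1
      rw [one_mul]
      exact ⟨h1, h3⟩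
    · obtain ⟨b, hb, rfl⟩ := Finset.mem_image.1 hs
      exact (Finset.mem_filter.1 hb).2
  have hΓ₂ : Γ₂.card ≤ δ * (E₂ \ E₁).card := by
    refine (card_le_mul_card_image_ordCompl (M := 2 ^ β * N) (c := 2 ^ δ) (δ := δ)
      fun b hb => ?_).trans (Nat.mul_le_mul_left _ (Finset.card_le_card fun s hs => ?_))
    · obtain ⟨hb1, hb2⟩ := Finset.mem_filter.1 hb
      obtain ⟨-, h3, -, h4⟩ := hΓ_mem b hb1
      exact ⟨h4 hb2, Nat.mul_le_mul_left _ h3⟩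
    · obtain ⟨b, hb, rfl⟩ := Finset.mem_image.1 hs
      obtain ⟨hb1, hb2⟩ := Finset.mem_filter.1 hb
      exact Finset.mem_sdiff.2 ⟨(hΓ_mem b hb1).2.2.1, hb2⟩
  calc (β + 1) * E.card = Γ₁.card + Γ₂.card := by
        rw [← hcard]; exact (Finset.card_filter_add_card_filter_not _).symm
    _ ≤ β * E₁.card + δ * (E₂ \ E₁).card := Nat.add_le_add hΓ₁ hΓ₂

end

/-- Chebyshev's upper bound for the primes in `[2 ^ (β + 1 / 2), m]`. -/
lemma mul_card_le_of_le_sq {G : Finset ℕ} {m β : ℕ} (hG : ∀ p ∈ G, p.Prime ∧ p ≤ m)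
    (hsq : ∀ p ∈ G, 2 ^ (2 * β + 1) ≤ p ^ 2) : (2 * β + 1) * G.card ≤ 4 * m := by
  have h1 : ∏ p ∈ G, p ≤ 4 ^ m := by
    refine le_trans ?_ (primorial_le_four_pow m)
    refine Finset.prod_le_prod_of_subset_of_one_le' (fun p hp => ?_) fun p hp _ => ?_
    · exact Finset.mem_filter.2 ⟨Finset.mem_range.2 (Nat.lt_succ_iff.2 (hG p hp).2), (hG p hp).1⟩
    · exact (Finset.mem_filter.1 hp).2.one_le
  have h2 : (2 ^ (2 * β + 1)) ^ G.card ≤ (∏ p ∈ G, p) ^ 2 := by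
    rw [← Finset.prod_pow, ← Finset.prod_const]
    exact Finset.prod_le_prod' hsq
  have h3 : 2 ^ ((2 * β + 1) * G.card) ≤ 2 ^ (4 * m) := by
    calc 2 ^ ((2 * β + 1) * G.card) = (2 ^ (2 * β + 1)) ^ G.card := pow_mul _ _ _
      _ ≤ (4 ^ m) ^ 2 := h2.trans (Nat.pow_le_pow_left h1 2)
      _ = 2 ^ (4 * m) := by
        rw [show 4 = 2 ^ 2 by norm_num, ← pow_mul, ← pow_mul]; congr 1; ring
  exact (Nat.pow_le_pow_iff_right (by norm_num)).1 h3

lemma card_boundedOmega_add_le {G₀ G₁ G₂ : Finset ℕ} (hG : ∀ p ∈ G₀, p.Prime)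
    (h₁ : Disjoint G₀ G₁) (h₂ : Disjoint G₀ G₂) (R h c₁ c₂ : ℕ) :
    ((boundedOmega G₀ G₁ G₂ (R + h) c₁ c₂).card : ℝ) ≤
      (1 + G₀.card / (R + 1)) ^ h * (boundedOmega G₀ G₁ G₂ R c₁ c₂).card := by
  induction h with
  | zero => simp
  | succ h ih =>
    have hstep : ((R + h : ℕ) + 1 : ℝ) * (boundedOmega G₀ G₁ G₂ (R + h + 1) c₁ c₂).card =
        ((R + h : ℕ) + 1 + G₀.card) * (boundedOmega G₀ G₁ G₂ (R + h) c₁ c₂).card := by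
      exact_mod_cast succ_mul_card_boundedOmega hG h₁ h₂ (R + h) c₁ c₂
    have heq : ((boundedOmega G₀ G₁ G₂ (R + h + 1) c₁ c₂).card : ℝ) =
        (1 + G₀.card / ((R + h : ℕ) + 1)) * (boundedOmega G₀ G₁ G₂ (R + h) c₁ c₂).card := by
      field_simp
      linarith
    calc ((boundedOmega G₀ G₁ G₂ (R + (h + 1)) c₁ c₂).card : ℝ)
        = (1 + G₀.card / ((R + h : ℕ) + 1)) * (boundedOmega G₀ G₁ G₂ (R + h) c₁ c₂).card := heq
      _ ≤ (1 + G₀.card / (R + 1)) *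
          ((1 + G₀.card / (R + 1)) ^ h * (boundedOmega G₀ G₁ G₂ R c₁ c₂).card) := by
        gcongr
        linarith [(Nat.cast_nonneg h : (0 : ℝ) ≤ h)]
      _ = _ := by ring

lemma one_add_pow_le {s : ℝ} (hs : 0 ≤ s) {h : ℕ} (hh : 2 * (h * s) ≤ 1) :
    (1 + s) ^ h ≤ 1 + 2 * (h * s) := by
  induction h with
  | zero => simp
  | succ h ih =>
    push_cast at hh ⊢
    have h0 : 2 * (h * s) ≤ 1 := by linarith
    calc (1 + s) ^ (h + 1) ≤ (1 + 2 * (h * s)) * (1 + s) := by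
          rw [pow_succ]; exact mul_le_mul_of_nonneg_right (ih h0) (by linarith)
      _ ≤ 1 + 2 * ((h + 1) * s) := by nlinarith

lemma two_pow_fourteen_mul_sq_le {β : ℕ} (hβ : 30 ≤ β) : 2 ^ 14 * β ^ 2 ≤ 2 ^ β := by
  induction β, hβ using Nat.le_induction with
  | base => norm_num
  | succ β hβ ih => rw [pow_succ 2 β]; nlinarith

/-- The numerical contradiction behind the counting argument. -/
lemma mul_add_lt_of_le {b e e₁ s : ℝ} (hb : 50000 ≤ b) (he : 0 < e) (he₁0 : 0 ≤ e₁)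
    (hs : 12 * s ≤ 1 / 4) (he₁ : e₁ ≤ (1 + 1 / (4 * b)) * ((1 + 1 / (4 * b)) * e)) :
    b * e₁ + 12 * (s * e₁) < (b + 1) * e := by
  have hub : 1 / (4 * b) * b = 1 / 4 := by field_simp
  have hu0 : 0 ≤ 1 / (4 * b) := by positivity
  generalize 1 / (4 * b) = u at *
  have hu1 : u ≤ 1 / 4 := by nlinarith
  have hu2 : u * u ≤ 1 / 4 * u := mul_le_mul_of_nonneg_right hu1 hu0
  have hu3 : u * u * b = 1 / 4 * u := by rw [mul_assoc, hub]; ring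
  have hlt : (b + 1 / 4) * ((1 + u) * (1 + u)) < b + 1 := by nlinarith
  calc b * e₁ + 12 * (s * e₁) = (b + 12 * s) * e₁ := by ring
    _ ≤ (b + 1 / 4) * e₁ := by gcongr
    _ ≤ (b + 1 / 4) * ((1 + u) * ((1 + u) * e)) := by gcongr
    _ = (b + 1 / 4) * ((1 + u) * (1 + u)) * e := by ring
    _ < (b + 1) * e := by gcongr

set_option maxHeartbeats 1000000 in
/-- Sufficiently long initial segments `[1, N]` cannot be matched with distinct multiples in
`(N, 2 ^ β * N]`. -/
theorem exists_forall_not_matching : ∃ β₀ : ℕ, ∀ β ≥ β₀, ∀ N : ℕ,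
    2 ^ (β + 1 + (2 * β + 1) * (3 * 2 ^ (2 * β - 8))) ≤ N → ∀ a : ℕ → ℕ,
    (∀ i ∈ Finset.Icc 1 N, i ∣ a i) → (∀ i ∈ Finset.Icc 1 N, N < a i ∧ a i ≤ 2 ^ β * N) →
    ¬ Set.InjOn a (Finset.Icc 1 N) := by
  refine ⟨50000, fun β hβ N hN a ha_dvd ha_mem ha_inj => ?_⟩
  obtain ⟨R, hR⟩ : ∃ R : ℕ, R + 1 = 2 ^ (2 * β - 8) :=
    ⟨2 ^ (2 * β - 8) - 1, Nat.sub_add_cancel Nat.one_le_two_pow⟩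
  set y : ℕ := 2 ^ (2 * β + 1) with hy
  set G₀ := (Finset.range y).filter fun p => p.Prime ∧ p ≠ 2 ∧ p ^ 2 < y with hG₀
  set G₁ := (Finset.range y).filter fun p => p.Prime ∧ p ≠ 2 ∧ y ≤ p ^ 2 ∧ 2 ^ 12 * p < y with hG₁
  set G₂ := (Finset.range y).filter fun p => p.Prime ∧ p ≠ 2 ∧ y ≤ p ^ 2 ∧ y ≤ 2 ^ 12 * p with hG₂
  have m₀ : ∀ p, p ∈ G₀ ↔ p < y ∧ p.Prime ∧ p ≠ 2 ∧ p ^ 2 < y := fun p => by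
    rw [hG₀, Finset.mem_filter, Finset.mem_range]
  have m₁ : ∀ p, p ∈ G₁ ↔ p < y ∧ p.Prime ∧ p ≠ 2 ∧ y ≤ p ^ 2 ∧ 2 ^ 12 * p < y := fun p => by
    rw [hG₁, Finset.mem_filter, Finset.mem_range]
  have m₂ : ∀ p, p ∈ G₂ ↔ p < y ∧ p.Prime ∧ p ≠ 2 ∧ y ≤ p ^ 2 ∧ y ≤ 2 ^ 12 * p := fun p => by
    rw [hG₂, Finset.mem_filter, Finset.mem_range]
  clear_value G₀ G₁ G₂
  have d₀₁ : Disjoint G₀ G₁ := Finset.disjoint_left.2 fun p h h' =>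
    absurd ((m₀ p).1 h).2.2.2 (not_lt.2 ((m₁ p).1 h').2.2.2.1)
  have d₀₂ : Disjoint G₀ G₂ := Finset.disjoint_left.2 fun p h h' =>
    absurd ((m₀ p).1 h).2.2.2 (not_lt.2 ((m₂ p).1 h').2.2.2.1)
  have d₁₂ : Disjoint G₁ G₂ := Finset.disjoint_left.2 fun p h h' =>
    absurd ((m₁ p).1 h).2.2.2.2 (not_lt.2 ((m₂ p).1 h').2.2.2.2)
  have hkey := mul_card_boundedOmega_le (G₀ := G₀) (G₁ := G₁) (G₂ := G₂) (R := R) (δ := 12) hy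
    (fun p hp => by
      rcases Finset.mem_union.1 hp with hp | hp
      · rcases Finset.mem_union.1 hp with hp | hp
        · obtain ⟨h1, h2, h3, -⟩ := (m₀ p).1 hp; exact ⟨h2, h3, h1.le⟩
        · obtain ⟨h1, h2, h3, -⟩ := (m₁ p).1 hp; exact ⟨h2, h3, h1.le⟩
      · obtain ⟨h1, h2, h3, -⟩ := (m₂ p).1 hp; exact ⟨h2, h3, h1.le⟩)
    (fun p hp hp2 hpy => by
      rcases lt_or_ge (p ^ 2) y with h | h
      · simp [(m₀ p).2 ⟨hpy, hp, hp2, h⟩]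
      rcases lt_or_ge (2 ^ 12 * p) y with h' | h'
      · simp [(m₁ p).2 ⟨hpy, hp, hp2, h, h'⟩]
      · simp [(m₂ p).2 ⟨hpy, hp, hp2, h, h'⟩])
    d₁₂
    (fun p hp => by
      rcases Finset.mem_union.1 hp with hp | hp
      · exact ((m₁ p).1 hp).2.2.2.1
      · exact ((m₂ p).1 hp).2.2.2.1)
    (fun p hp => ((m₂ p).1 hp).2.2.2.2)
    (by
      refine le_trans ?_ hN
      rw [hy, ← pow_mul, ← pow_add]
      refine Nat.pow_le_pow_right (by norm_num) ?_
      have : 3 * R ≤ 3 * 2 ^ (2 * β - 8) := by omega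
      gcongr)
    ha_dvd ha_mem ha_inj
  have hdvd : y = 2 ^ 9 * (R + 1) := by
    rw [hR, hy, ← pow_add]
    congr 1
    omega
  have hc₁ : (2 * β + 1) * G₁.card * 2 ≤ R + 1 := by
    have := mul_card_le_of_le_sq (G := G₁) (m := y / 2 ^ 12) (β := β) (fun p hp => by
      obtain ⟨-, h2, -, -, h3⟩ := (m₁ p).1 hp
      exact ⟨h2, by omega⟩) (fun p hp => ((m₁ p).1 hp).2.2.2.1)
    omega
  have hc₂ : (2 * β + 1) * G₂.card ≤ 2 ^ 11 * (R + 1) := by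
    have := mul_card_le_of_le_sq (G := G₂) (m := y) (β := β) (fun p hp => by
      obtain ⟨h1, h2, -⟩ := (m₂ p).1 hp
      exact ⟨h2, h1.le⟩) (fun p hp => ((m₂ p).1 hp).2.2.2.1)
    omega
  have hc₀ : G₀.card * 2 ^ β ≤ 2 ^ 9 * (R + 1) := by
    have h1 : G₀ ⊆ Finset.range (2 ^ (β + 1)) := fun p hp => by
      rw [Finset.mem_range]
      refine lt_of_pow_lt_pow_left₀ 2 (by positivity) (((m₀ p).1 hp).2.2.2.trans ?_)
      rw [hy, ← pow_mul]
      exact Nat.pow_lt_pow_right (by norm_num) (by omega)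
    have h2 := Finset.card_le_card h1
    rw [Finset.card_range] at h2
    calc G₀.card * 2 ^ β ≤ 2 ^ (β + 1) * 2 ^ β := Nat.mul_le_mul_right _ h2
      _ = 2 ^ 9 * (R + 1) := by rw [← hdvd, hy, ← pow_add]; congr 1; ring
  have hβ2 := two_pow_fourteen_mul_sq_le (β := β) (by omega)
  set h := 2 * β + 1 with hh
  set e := ((boundedOmega G₀ G₁ G₂ R R R).card : ℝ) with he
  set e₁ := ((boundedOmega G₀ G₁ G₂ (R + h) (R + 1) R).card : ℝ) with he₁
  set s₀ : ℝ := G₀.card / (R + 1) with hs₀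
  set s₁ : ℝ := G₁.card / (R + 1) with hs₁
  set s₂ : ℝ := G₂.card / (R + 1) with hs₂
  have hβr : (50000 : ℝ) ≤ β := by exact_mod_cast hβ
  have hR0 : (0 : ℝ) < (R : ℝ) + 1 := by positivity
  have he0 : 0 < e := by
    rw [he, Nat.cast_pos, Finset.card_pos]
    exact ⟨1, mem_boundedOmega.2 ⟨one_ne_zero, by simp, by simp [omegaOn], by simp [omegaOn],
      by simp [omegaOn]⟩⟩
  have hb₁ : s₁ ≤ 1 / (4 * β) := by
    rw [hs₁, div_le_div_iff₀ hR0 (by linarith)]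
    have : ((2 * β + 1) * G₁.card * 2 : ℝ) ≤ R + 1 := by exact_mod_cast hc₁
    nlinarith [(Nat.cast_nonneg G₁.card : (0 : ℝ) ≤ G₁.card)]
  have hb₂ : 12 * s₂ ≤ 1 / 4 := by
    rw [hs₂, ← mul_div_assoc, div_le_div_iff₀ hR0 (by norm_num)]
    have : ((2 * β + 1) * G₂.card : ℝ) ≤ 2 ^ 11 * (R + 1) := by exact_mod_cast hc₂
    nlinarith [(Nat.cast_nonneg G₂.card : (0 : ℝ) ≤ G₂.card)]
  have hs₀0 : 0 ≤ s₀ := by positivity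
  have hs₁0 : 0 ≤ s₁ := by positivity
  have hs₂0 : 0 ≤ s₂ := by positivity
  have hb₀ : (h * s₀ : ℝ) * (8 * β) ≤ 1 := by
    have h1 : (G₀.card * 2 ^ β : ℝ) ≤ 2 ^ 9 * (R + 1) := by exact_mod_cast hc₀
    have h2 : (2 ^ 14 * β ^ 2 : ℝ) ≤ 2 ^ β := by exact_mod_cast hβ2
    have h3 : s₀ * (2 ^ 14 * β ^ 2) ≤ 2 ^ 9 := by
      refine (mul_le_mul_of_nonneg_left h2 hs₀0).trans ?_
      rw [hs₀, div_mul_eq_mul_div, div_le_iff₀ hR0]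
      exact h1
    have h4 : (h : ℝ) ≤ 3 * β := by rw [hh]; push_cast; linarith
    calc (h * s₀ : ℝ) * (8 * β) ≤ (3 * β * s₀) * (8 * β) := by gcongr
      _ ≤ 1 := by nlinarith
  have hp₀ : (1 + s₀) ^ h ≤ 1 + 1 / (4 * β) := by
    have hle : (h * s₀ : ℝ) ≤ 1 / (8 * β) := by rwa [le_div_iff₀ (by linarith)]
    have h1 : 1 / (8 * β : ℝ) ≤ 1 / 2 := by
      apply div_le_div_of_nonneg_left <;> linarith
    refine (one_add_pow_le hs₀0 (by linarith)).trans ?_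
    have : 1 / (4 * β : ℝ) = 2 * (1 / (8 * β)) := by field_simp; norm_num
    linarith
  have hE₁ : e₁ ≤ (1 + s₀) ^ h * ((1 + s₁) * e) := by
    refine (card_boundedOmega_add_le (fun p hp => ((m₀ p).1 hp).2.1) d₀₁ d₀₂ R h (R + 1) R).trans ?_
    refine mul_le_mul_of_nonneg_left ?_ (by positivity)
    have := card_boundedOmega_add_le (fun p hp => ((m₁ p).1 hp).2.1) d₁₂ d₀₁.symm R 1 R R
    rw [pow_one, ← boundedOmega_rotate (G₀ := G₀) R (R + 1) R,
      ← boundedOmega_rotate (G₀ := G₀) R R R] at this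
    exact this
  have hE₂ : ((boundedOmega G₀ G₁ G₂ (R + h) (R + 1) (R + 1) \
      boundedOmega G₀ G₁ G₂ (R + h) (R + 1) R).card : ℝ) ≤ s₂ * e₁ := by
    have h1 := card_boundedOmega_add_le (fun p hp => ((m₂ p).1 hp).2.1) d₀₂.symm d₁₂.symm
      R 1 (R + h) (R + 1)
    rw [pow_one, boundedOmega_rotate (G₀ := G₂) (R + 1), boundedOmega_rotate (G₀ := G₂) R] at h1
    rw [Finset.cast_card_sdiff (boundedOmega_mono le_rfl le_rfl (Nat.le_succ R))]
    linarith
  have hc : (β + 1 : ℝ) * e ≤ β * e₁ + 12 * ((boundedOmega G₀ G₁ G₂ (R + h) (R + 1) (R + 1) \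
      boundedOmega G₀ G₁ G₂ (R + h) (R + 1) R).card : ℝ) := by
    rw [he, he₁]
    exact_mod_cast hkey
  have hle : e₁ ≤ (1 + 1 / (4 * β)) * ((1 + 1 / (4 * β)) * e) := hE₁.trans (by gcongr)
  have hlt := mul_add_lt_of_le hβr he0 (Nat.cast_nonneg _) hb₂ hle
  linarith

lemma exists_matching (n m : ℕ) : ∃ a : ℕ → ℕ, (∀ i ∈ Finset.Icc 1 n, i ∣ a i) ∧
    (∀ i ∈ Finset.Icc 1 n, m < a i ∧ a i ≤ m + f n m) ∧ Set.InjOn a (Finset.Icc 1 n) := by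
  refine Nat.sInf_mem (s := {L : ℕ | ∃ a : ℕ → ℕ, (∀ i ∈ Finset.Icc 1 n, i ∣ a i) ∧
    (∀ i ∈ Finset.Icc 1 n, m < a i ∧ a i ≤ m + L) ∧ Set.InjOn a (Finset.Icc 1 n)}) ?_
  refine ⟨n * (m + 1), fun i => i * (m + 1), fun i _ => dvd_mul_right _ _, fun i hi => ?_,
    fun i _ j _ hij => Nat.eq_of_mul_eq_mul_right (Nat.succ_pos m) hij⟩
  obtain ⟨h1, h2⟩ := Finset.mem_Icc.1 hi
  constructor
  · nlinarith
  · exact (Nat.mul_le_mul_right (m + 1) h2).trans (Nat.le_add_left _ _)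

/-- The numerical comparison between `n` and the dyadic scale of `k`. -/
lemma size_bound {n k β : ℕ} (hn : 0 < n) {X Q : ℝ} (hX : X = Real.log n)
    (hQ : Q = X / Real.log X) (hX0 : 0 < X) (hΛ : 32 ≤ Real.log X) (hQ100 : 100 ≤ Q)
    (hk : (k : ℝ) ≤ 0.6 * √Q + 1) (hβ8 : 8 ≤ 2 * β) (hβ : 2 ^ β ≤ 8 * k) :
    2 ^ (β + 1 + (2 * β + 1) * (3 * 2 ^ (2 * β - 8))) ≤ n := by
  have hQ0 : 0 ≤ Q := by linarith
  have hQX : Q * Real.log X = X := by rw [hQ]; field_simp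
  have hs : 10 ≤ √Q := Real.le_sqrt_of_sq_le (by linarith)
  have hk' : (k : ℝ) ≤ 0.7 * √Q := by linarith
  have hk2 : (k : ℝ) ^ 2 ≤ 0.49 * Q := by
    have := pow_le_pow_left₀ (Nat.cast_nonneg k) hk' 2
    rw [mul_pow, Real.sq_sqrt hQ0] at this
    linarith
  have hβr : ((2 : ℝ) ^ β) ≤ 8 * k := by exact_mod_cast hβ
  have h4 : (2 : ℝ) ^ (2 * β) ≤ 32 * Q := by
    have := pow_le_pow_left₀ (by positivity) hβr 2
    rw [← pow_mul, mul_comm β 2] at this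
    nlinarith
  have hlog2 : Real.log 2 ≤ 1 := by linarith [Real.log_two_lt_d9]
  have hlog2' : 0 < Real.log 2 := Real.log_pos (by norm_num)
  have hβΛ : 2 * β * Real.log 2 ≤ Real.log X := by
    have : (2 : ℝ) ^ (2 * β) ≤ X := by nlinarith
    have := Real.log_le_log (by positivity) this
    rw [Real.log_pow] at this
    push_cast at this
    exact this
  have h8 : (2 : ℝ) ^ (2 * β - 8) ≤ Q / 8 := by
    have : (2 : ℝ) ^ (2 * β) = 2 ^ (2 * β - 8) * 256 := by
      rw [show (256 : ℝ) = 2 ^ 8 by norm_num, ← pow_add, Nat.sub_add_cancel hβ8]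
    linarith
  have hΛX : Real.log X ≤ X / 32 := by nlinarith
  have hmain : ((β + 1 + (2 * β + 1) * (3 * 2 ^ (2 * β - 8)) : ℕ) : ℝ) * Real.log 2 ≤ X := by
    push_cast
    calc (β + 1 + (2 * β + 1) * (3 * 2 ^ (2 * β - 8)) : ℝ) * Real.log 2
        = (β * Real.log 2 + Real.log 2) +
          (2 * β * Real.log 2 + Real.log 2) * (3 * 2 ^ (2 * β - 8)) := by ring
      _ ≤ (Real.log X + 1) + (Real.log X + 1) * (3 * (Q / 8)) := by
        have : 0 ≤ β * Real.log 2 := by positivity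
        gcongr
        linarith
      _ ≤ X := by nlinarith
  have hnr : (0 : ℝ) < n := by exact_mod_cast hn
  rw [← Real.log_pow, hX] at hmain
  exact_mod_cast (Real.log_le_log_iff (by positivity) hnr).1 hmain

theorem stmt_5 : ∃ N : ℕ, ∀ n : ℕ, N ≤ n → 0 < n →
    ∀ k : ℕ, k = ⌈0.6 * Real.sqrt (Real.log n / Real.log (Real.log n))⌉₊ →
      (f (k * n) (k * n) : ℝ) > (2 + 1 / 100) * k ^ 2 * n := by
  obtain ⟨β₀, hβ₀⟩ := exists_forall_not_matching
  set K : ℝ := 100 + (2 ^ (β₀ + 4)) ^ 2 with hK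
  have hlim : Filter.Tendsto (fun n : ℕ => Real.log n) Filter.atTop Filter.atTop :=
    Real.tendsto_log_atTop.comp tendsto_natCast_atTop_atTop
  obtain ⟨N, hN⟩ := Filter.eventually_atTop.1
    (hlim.eventually_ge_atTop (max (Real.exp 32) ((2 * K) ^ 2)))
  refine ⟨N, fun n hn hn0 k hk => ?_⟩
  obtain ⟨hX1, hX2⟩ := max_le_iff.1 (hN n hn)
  set X := Real.log n with hX
  set Q := X / Real.log X with hQ
  have hX0 : 0 < X := (Real.exp_pos _).trans_le hX1
  have hΛ : 32 ≤ Real.log X := (Real.le_log_iff_exp_le hX0).2 hX1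
  have hK0 : 0 < K := by positivity
  have hsX : 2 * K ≤ √X := Real.le_sqrt_of_sq_le hX2
  have hQK : K ≤ Q := by
    have h1 : Real.log X ≤ 2 * √X := by
      have h2 := Real.log_le_sub_one_of_pos (Real.sqrt_pos.2 hX0)
      rw [Real.log_sqrt hX0.le] at h2
      linarith
    rw [hQ, le_div_iff₀ (by linarith)]
    calc K * Real.log X ≤ K * (2 * √X) := by gcongr
      _ = (2 * K) * √X := by ring
      _ ≤ √X * √X := by gcongr
      _ = X := Real.mul_self_sqrt hX0.le
  have hsQ : (2 : ℝ) ^ (β₀ + 4) ≤ √Q := Real.le_sqrt_of_sq_le (by linarith)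
  have hklow : 0.6 * √Q ≤ k := by rw [hk]; exact Nat.le_ceil _
  have hkup : (k : ℝ) ≤ 0.6 * √Q + 1 := by
    rw [hk]; exact (Nat.ceil_lt_add_one (by positivity)).le
  have hk4 : 2 ^ (β₀ + 4) ≤ 4 * k := by
    have : (2 : ℝ) ^ (β₀ + 4) ≤ 4 * k := by
      linarith [Real.sqrt_nonneg Q]
    exact_mod_cast this
  have hk1 : 1 < 4 * k := lt_of_lt_of_le (Nat.one_lt_two_pow (by omega)) hk4
  set β := Nat.clog 2 (4 * k) with hβ
  have hβ1 : 4 * k ≤ 2 ^ β := Nat.le_pow_clog (by norm_num) _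
  have hβ2 : 2 ^ (β - 1) < 4 * k := Nat.pow_pred_clog_lt_self (by norm_num) hk1
  have hββ₀ : β₀ + 4 ≤ β := (Nat.pow_le_pow_iff_right (by norm_num)).1 (hk4.trans hβ1)
  have hβ3 : 2 ^ β ≤ 8 * k := by
    have : 2 ^ β = 2 ^ (β - 1) * 2 := by rw [← pow_succ, Nat.sub_add_cancel (by omega)]
    omega
  have hsize := size_bound hn0 hX hQ hX0 hΛ (by nlinarith [sq_nonneg ((2 : ℝ) ^ (β₀ + 4))])
    hkup (by omega) hβ3
  by_contra hcon
  rw [gt_iff_lt, not_lt] at hcon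
  obtain ⟨a, ha1, ha2, ha3⟩ := exists_matching (k * n) (k * n)
  have hkn : k * n + f (k * n) (k * n) ≤ 2 ^ β * (k * n) := by
    have hk1' : (1 : ℝ) ≤ k := by exact_mod_cast (by omega : 1 ≤ k)
    have h1 : ((k * n + f (k * n) (k * n) : ℕ) : ℝ) ≤ ((4 * k * (k * n) : ℕ) : ℝ) := by
      push_cast
      have h2 : (k : ℝ) * n ≤ k * (k * n) := le_mul_of_one_le_left (by positivity) hk1'
      nlinarith
    exact (Nat.cast_le.1 h1).trans (Nat.mul_le_mul_right _ hβ1)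
  exact hβ₀ β (by omega) (k * n) (hsize.trans (Nat.le_mul_of_pos_left n (by omega))) a ha1
    (fun i hi => ⟨(ha2 i hi).1, (ha2 i hi).2.trans hkn⟩) ha3
end

section
/- For all sufficiently large positive integers n, if k denotes the integer k = ⌈0.6 · √(log n / log log n)⌉, then (1/100) · k² · n > f(n, n). (Here log denotes the natural logarithm.) -/
open Real

/-- A fractional matching saturating every `i ∈ I` yields a system of distinct representatives. -/
lemma exists_injOn_of_fractional_matching (I : Finset ℕ) (A : ℕ → Finset ℕ) (w : ℕ → ℕ → ℝ)
    (hw : ∀ i a, 0 ≤ w i a) (h1 : ∀ i ∈ I, 1 ≤ ∑ a ∈ A i, w i a)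
    (h2 : ∀ a, ∑ i ∈ I with a ∈ A i, w i a ≤ 1) :
    ∃ g : ℕ → ℕ, Set.InjOn g I ∧ ∀ i ∈ I, g i ∈ A i := by
  have hall : ∀ s : Finset I, s.card ≤ (s.biUnion fun i => A i).card := by
    intro s
    set S := s.map (Function.Embedding.subtype _) with hS
    have hSI : S ⊆ I := by
      intro i hi
      simp only [hS, Finset.mem_map, Function.Embedding.subtype_apply] at hi
      obtain ⟨j, -, rfl⟩ := hi
      exact j.2
    have hU : (s.biUnion fun i => A i) = S.biUnion A := by
      ext a
      simp [hS]
    have hc : s.card = S.card := by simp [hS]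
    rw [hU, hc]
    have key : (S.card : ℝ) ≤ ((S.biUnion A).card : ℝ) := by
      calc (S.card : ℝ) = ∑ i ∈ S, (1 : ℝ) := by simp
        _ ≤ ∑ i ∈ S, ∑ a ∈ A i, w i a := Finset.sum_le_sum fun i hi => h1 i (hSI hi)
        _ = ∑ a ∈ S.biUnion A, ∑ i ∈ S with a ∈ A i, w i a := by
          refine Finset.sum_comm' fun i a => ?_
          simp only [Finset.mem_filter, Finset.mem_biUnion]
          constructor
          · rintro ⟨hi, ha⟩
            exact ⟨⟨hi, ha⟩, i, hi, ha⟩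
          · rintro ⟨h, -⟩
            exact h
        _ ≤ ∑ a ∈ S.biUnion A, (1 : ℝ) := by
          refine Finset.sum_le_sum fun a _ => le_trans ?_ (h2 a)
          exact Finset.sum_le_sum_of_subset_of_nonneg (Finset.filter_subset_filter _ hSI)
            fun i _ _ => hw i a
        _ = _ := by simp
    exact_mod_cast key
  obtain ⟨g, hg, hgA⟩ := (Finset.all_card_le_biUnion_card_iff_exists_injective
    (fun i : I => A i)).1 hall
  refine ⟨fun i => if h : i ∈ I then g ⟨i, h⟩ else 0, ?_, ?_⟩
  · intro i hi j hj hij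
    have hi' : i ∈ I := hi
    have hj' : j ∈ I := hj
    simp only [hi', hj', dif_pos] at hij
    simpa using hg hij
  · intro i hi
    simp only [hi, dif_pos]
    exact hgA ⟨i, hi⟩

lemma log_add_one_div_le_sum_inv {s e : ℕ} (h : s ≤ e) :
    log ((e + 1) / (s + 1)) ≤ ∑ t ∈ Finset.Ioc s e, (t : ℝ)⁻¹ := by
  induction e, h using Nat.le_induction with
  | base => simp [div_self (by positivity : (s : ℝ) + 1 ≠ 0)]
  | succ e he ih =>
    rw [Finset.sum_Ioc_succ_top (by omega)]
    have h3 : log (((e : ℝ) + 2) / (e + 1)) ≤ ((e : ℝ) + 1)⁻¹ := by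
      refine (log_le_sub_one_of_pos (by positivity)).trans (le_of_eq ?_)
      field_simp
      ring
    have h4 : (((e + 1 : ℕ) : ℝ) + 1) / (s + 1) = ((e + 1) / (s + 1)) * ((e + 2) / (e + 1)) := by
      push_cast
      field_simp
      ring
    rw [h4, log_mul (by positivity) (by positivity)]
    push_cast
    linarith

lemma sum_inv_Ioc_le_log {s e : ℕ} (hs : 0 < s) (h : s ≤ e) :
    ∑ t ∈ Finset.Ioc s e, (t : ℝ)⁻¹ ≤ log (e / s) := by
  have hs' : (0 : ℝ) < s := by exact_mod_cast hs
  induction e, h using Nat.le_induction with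
  | base => simp [div_self hs'.ne']
  | succ e he ih =>
    rw [Finset.sum_Ioc_succ_top (by omega)]
    have he' : (0 : ℝ) < e := by exact_mod_cast hs.trans_le he
    have h3 : ((e : ℝ) + 1)⁻¹ ≤ log (((e : ℝ) + 1) / e) := by
      refine le_trans (le_of_eq ?_) (one_sub_inv_le_log_of_pos (by positivity))
      field_simp
      ring
    have h4 : (((e + 1 : ℕ) : ℝ)) / s = (e / s) * ((e + 1) / e) := by
      push_cast
      field_simp
    rw [h4, log_mul (by positivity) (by positivity)]
    push_cast
    linarith

lemma sum_inv_le_one_add_log {U : Finset ℕ} {X : ℕ} (hX : 0 < X) (hU : ∀ t ∈ U, 0 < t)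
    (h : ∀ t ∈ U, ∀ u ∈ U, u ≤ X * t) : ∑ t ∈ U, (t : ℝ)⁻¹ ≤ 1 + log X := by
  rcases U.eq_empty_or_nonempty with rfl | hne
  · have : (1 : ℝ) ≤ X := by exact_mod_cast hX
    simpa using add_nonneg zero_le_one (log_nonneg this)
  set s := U.min' hne
  have hsU : s ∈ U := U.min'_mem hne
  have hs : 0 < s := hU s hsU
  have hsX : s ≤ X * s := Nat.le_mul_of_pos_left s hX
  have hs' : (0 : ℝ) < s := by exact_mod_cast hs
  have hsub : U ⊆ Finset.Icc s (X * s) := fun t ht =>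
    Finset.mem_Icc.2 ⟨U.min'_le t ht, h s hsU t ht⟩
  calc ∑ t ∈ U, (t : ℝ)⁻¹ ≤ ∑ t ∈ Finset.Icc s (X * s), (t : ℝ)⁻¹ :=
        Finset.sum_le_sum_of_subset_of_nonneg hsub fun _ _ _ => by positivity
    _ = (s : ℝ)⁻¹ + ∑ t ∈ Finset.Ioc s (X * s), (t : ℝ)⁻¹ :=
        (Finset.add_sum_Ioc_eq_sum_Icc hsX).symm
    _ ≤ 1 + log ((X * s : ℕ) / s) := by
        refine add_le_add ?_ (sum_inv_Ioc_le_log hs hsX)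
        exact inv_le_one_of_one_le₀ (by exact_mod_cast hs)
    _ = 1 + log X := by
        push_cast
        rw [mul_div_cancel_right₀ _ hs'.ne']

lemma card_primeFactors_le_two_mul_log {a : ℕ} (ha : a ≠ 0) :
    (a.primeFactors.card : ℝ) ≤ 2 * log a := by
  have h1 : 2 ^ a.primeFactors.card ≤ a :=
    (Finset.pow_card_le_prod _ _ 2 fun p hp => (Nat.prime_of_mem_primeFactors hp).two_le).trans
      (Nat.le_of_dvd (Nat.pos_of_ne_zero ha) (Nat.prod_primeFactors_dvd a))
  have h2 : (2 : ℝ) ^ a.primeFactors.card ≤ a := by exact_mod_cast h1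
  have h3 := log_le_log (by positivity) h2
  rw [log_pow] at h3
  nlinarith [log_two_gt_d9, (Nat.cast_nonneg a.primeFactors.card : (0 : ℝ) ≤ _)]

open Filter Asymptotics in
lemma eventually_half_le_theta : ∀ᶠ y : ℝ in atTop, y / 2 ≤ Chebyshev.theta y := by
  have h1 : ∀ᶠ y : ℝ in atTop, log y ≤ 0.01 * y ^ (1 / 2 : ℝ) := by
    have := (isLittleO_log_rpow_atTop (by norm_num : (0 : ℝ) < 1 / 2)).bound
      (by norm_num : (0 : ℝ) < 0.01)
    filter_upwards [this, eventually_ge_atTop 1] with y hy hy1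
    rwa [norm_of_nonneg (log_nonneg hy1), norm_of_nonneg (by positivity)] at hy
  filter_upwards [h1, eventually_ge_atTop 1000] with y hy hy1
  have h2 := Chebyshev.theta_ge' (x := y) (by linarith)
  rw [← sqrt_eq_rpow] at hy
  have hs : √y * √y = y := mul_self_sqrt (by linarith)
  have hs0 := sqrt_nonneg y
  have hs1 : 1 ≤ √y := by rw [one_le_sqrt]; linarith
  have h3 : 2 * √y * log y ≤ 0.02 * y := by nlinarith
  have h4 : log (y + 2) ≤ 0.02 * y := by
    have : log (y + 2) ≤ log (y * y) := log_le_log (by linarith) (by nlinarith)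
    rw [log_mul (by linarith) (by linarith)] at this
    nlinarith
  nlinarith [log_two_gt_d9]

open Filter Asymptotics in
/-- A power-saving form of Chebyshev's lower bound for the number of primes in `(x, y]`. -/
lemma eventually_rpow_le_card_primes : ∀ᶠ y : ℝ in atTop, ∀ x : ℝ, 0 ≤ x → 6 * x ≤ y →
    y ^ (11 / 12 : ℝ) ≤ (((Finset.Ioc ⌊x⌋₊ ⌊y⌋₊).filter Nat.Prime).card : ℝ) := by
  have h1 : ∀ᶠ y : ℝ in atTop, log y ≤ 0.1 * y ^ (1 / 12 : ℝ) := by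
    have := (isLittleO_log_rpow_atTop (by norm_num : (0 : ℝ) < 1 / 12)).bound
      (by norm_num : (0 : ℝ) < 0.1)
    filter_upwards [this, eventually_ge_atTop 1] with y hy hy1
    rwa [norm_of_nonneg (log_nonneg hy1), norm_of_nonneg (by positivity)] at hy
  filter_upwards [h1, eventually_half_le_theta, eventually_ge_atTop 2] with y hy hth hy2 x hx hxy
  have h2 := Chebyshev.theta_le_log4_mul_x hx
  have h3 : log 4 ≤ 1.4 := by
    rw [show (4 : ℝ) = 2 ^ 2 by norm_num, log_pow]
    push_cast
    linarith [log_two_lt_d9]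
  set P := (Finset.Ioc ⌊x⌋₊ ⌊y⌋₊).filter Nat.Prime with hP
  have hfl : ⌊x⌋₊ ≤ ⌊y⌋₊ := Nat.floor_mono (by linarith)
  have h4 : Chebyshev.theta y = Chebyshev.theta x + ∑ p ∈ P, log p := by
    rw [Chebyshev.theta, Chebyshev.theta, hP, Finset.sum_filter, Finset.sum_filter,
      Finset.sum_filter, Finset.sum_Ioc_consecutive _ (Nat.zero_le _) hfl]
  have h5 : ∑ p ∈ P, log (p : ℝ) ≤ P.card * log y := by
    rw [← nsmul_eq_mul]
    refine Finset.sum_le_card_nsmul _ _ _ fun p hp => ?_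
    rw [hP, Finset.mem_filter, Finset.mem_Ioc] at hp
    exact log_le_log (by exact_mod_cast hp.2.pos)
      ((Nat.le_floor_iff (by linarith)).1 hp.1.2)
  have h6 : y / 4 ≤ P.card * log y := by nlinarith
  have hy0 : 0 < y := by linarith
  have hsplit : y ^ (11 / 12 : ℝ) * y ^ (1 / 12 : ℝ) = y := by
    rw [← rpow_add hy0]
    norm_num
  have ha : 0 < y ^ (1 / 12 : ℝ) := by positivity
  have h7 : y / 4 ≤ P.card * (0.1 * y ^ (1 / 12 : ℝ)) :=
    h6.trans (mul_le_mul_of_nonneg_left hy (Nat.cast_nonneg _))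
  have h8 : y ^ (11 / 12 : ℝ) * y ^ (1 / 12 : ℝ) ≤ P.card * y ^ (1 / 12 : ℝ) := by
    rw [hsplit]
    linarith
  exact le_of_mul_le_mul_right h8 ha

lemma f_le_of_injOn {n m L : ℕ} {a : ℕ → ℕ} (hdvd : ∀ i ∈ Finset.Icc 1 n, i ∣ a i)
    (hmem : ∀ i ∈ Finset.Icc 1 n, m < a i ∧ a i ≤ m + L)
    (hinj : Set.InjOn a (Finset.Icc 1 n)) : f n m ≤ L :=
  Nat.sInf_le ⟨a, hdvd, hmem, hinj⟩

/-- A matching of `[1, n]` into its multiples in `(n, T n]`: the `i ≥ n / X` spread their weight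
over all cofactors, proportionally to the inverse of the cofactor, and the smaller `i` spread
theirs uniformly over the prime cofactors. -/
lemma f_self_le_mul {n T X : ℕ} {D : ℝ} (hn : 0 < n) (hX : 0 < X) (hTn : T ≤ n) (hT : 2 < T)
    (hlog : 2 * (1 + log X) ≤ log (T / 2)) (hD : 8 * log n ≤ D) (hD0 : 0 < D)
    (hprimes : ∀ i, 0 < i → X * i < n →
      D ≤ (((Finset.Ioc (n / i) (T * n / i)).filter Nat.Prime).card : ℝ)) :
    f n n ≤ T * n := by
  classical
  set Λ : ℝ := log (T / 2) with hΛ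
  have hX1 : (1 : ℝ) ≤ X := by exact_mod_cast hX
  have hΛ0 : 0 < Λ := by linarith [log_nonneg hX1]
  let C : ℕ → Finset ℕ := fun i =>
    if n ≤ X * i then Finset.Ioc (n / i) (T * n / i)
    else (Finset.Ioc (n / i) (T * n / i)).filter Nat.Prime
  let A : ℕ → Finset ℕ := fun i => (C i).image (i * ·)
  let w : ℕ → ℕ → ℝ := fun i a => if n ≤ X * i then ((a / i : ℕ) : ℝ)⁻¹ / Λ else D⁻¹
  have hC : ∀ i, C i ⊆ Finset.Ioc (n / i) (T * n / i) := by
    intro i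
    simp only [C]
    split_ifs
    · exact subset_rfl
    · exact Finset.filter_subset _ _
  have hA : ∀ i, 0 < i → ∀ a ∈ A i, i ∣ a ∧ n < a ∧ a ≤ T * n ∧ a / i ∈ C i := by
    intro i hi a ha
    obtain ⟨t, ht, rfl⟩ := Finset.mem_image.1 ha
    have ht' := Finset.mem_Ioc.1 (hC i ht)
    refine ⟨dvd_mul_right _ _, ?_, ?_, ?_⟩
    · have := (Nat.div_lt_iff_lt_mul hi).1 ht'.1
      rwa [mul_comm] at this
    · have := (Nat.le_div_iff_mul_le hi).1 ht'.2
      rwa [mul_comm] at this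
    · simpa only [Nat.mul_div_cancel_left t hi] using ht
  have hw : ∀ i a, 0 ≤ w i a := by
    intro i a
    simp only [w]
    split_ifs <;> positivity
  have hsumA : ∀ i, 0 < i → ∀ g : ℕ → ℝ, ∑ a ∈ A i, g a = ∑ t ∈ C i, g (i * t) := by
    intro i hi g
    exact Finset.sum_image fun s _ t _ hst => Nat.eq_of_mul_eq_mul_left hi hst
  have h1 : ∀ i ∈ Finset.Icc 1 n, 1 ≤ ∑ a ∈ A i, w i a := by
    intro i hi
    obtain ⟨hi0, hin⟩ := Finset.mem_Icc.1 hi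
    rw [hsumA i hi0]
    by_cases hlarge : n ≤ X * i
    · have e1 : ∑ t ∈ C i, w i (i * t) =
          (∑ t ∈ Finset.Ioc (n / i) (T * n / i), (t : ℝ)⁻¹) / Λ := by
        simp only [C, w, hlarge, if_true]
        rw [Finset.sum_div]
        refine Finset.sum_congr rfl fun t _ => ?_
        rw [Nat.mul_div_cancel_left t hi0]
      rw [e1, le_div_iff₀ hΛ0, one_mul]
      have hle : n / i ≤ T * n / i := Nat.div_le_div_right (Nat.le_mul_of_pos_left n (by omega))
      refine le_trans ?_ (log_add_one_div_le_sum_inv hle)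
      have hi' : (0 : ℝ) < i := by exact_mod_cast hi0
      have hin' : (i : ℝ) ≤ n := by exact_mod_cast hin
      have hT0 : (0 : ℝ) < T := by exact_mod_cast (by omega : 0 < T)
      refine log_le_log (by positivity) ?_
      rw [div_le_div_iff₀ (by norm_num) (by positivity)]
      have ha : ((n / i : ℕ) : ℝ) ≤ n / i := Nat.cast_div_le
      have hb : ((T * n : ℕ) : ℝ) / i < (T * n / i : ℕ) + 1 := by
        rw [div_lt_iff₀ hi']
        exact_mod_cast Nat.lt_mul_of_div_lt (Nat.lt_succ_self _) hi0
      have hc : 1 ≤ (n : ℝ) / i := (one_le_div hi').2 hin'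
      have hd : ((T * n : ℕ) : ℝ) / i = T * (n / i) := by push_cast; ring
      rw [hd] at hb
      have he : (T : ℝ) * ((n / i : ℕ) + 1) ≤ T * (n / i + n / i) :=
        mul_le_mul_of_nonneg_left (by linarith) hT0.le
      linarith
    · have e1 : ∑ t ∈ C i, w i (i * t) =
          (((Finset.Ioc (n / i) (T * n / i)).filter Nat.Prime).card : ℝ) * D⁻¹ := by
        simp only [C, w, hlarge, if_false]
        rw [Finset.sum_const, nsmul_eq_mul]
      rw [e1, ← div_eq_mul_inv, le_div_iff₀ hD0, one_mul]
      exact hprimes i hi0 (not_le.1 hlarge)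
  have h2 : ∀ a, ∑ i ∈ Finset.Icc 1 n with a ∈ A i, w i a ≤ 1 := by
    intro a
    set S := (Finset.Icc 1 n).filter fun i => a ∈ A i with hS
    have hSA : ∀ i ∈ S, 0 < i ∧ i ≤ n ∧ i ∣ a ∧ n < a ∧ a ≤ T * n ∧ a / i ∈ C i := by
      intro i hi
      obtain ⟨hi1, hi2⟩ := Finset.mem_filter.1 hi
      obtain ⟨hi0, hin⟩ := Finset.mem_Icc.1 hi1
      exact ⟨hi0, hin, hA i hi0 a hi2⟩
    have hinj : Set.InjOn (fun i => a / i) S := by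
      intro i hi j hj hij
      obtain ⟨hi0, -, ⟨s, rfl⟩, -, -, -⟩ := hSA i hi
      obtain ⟨hj0, -, ⟨t, ht⟩, h0, -, -⟩ := hSA j hj
      simp only at hij
      rw [Nat.mul_div_cancel_left s hi0, ht, Nat.mul_div_cancel_left t hj0] at hij
      subst hij
      exact Nat.eq_of_mul_eq_mul_right (Nat.pos_of_ne_zero (by rintro rfl; simp at h0)) ht
    rw [← Finset.sum_filter_add_sum_filter_not S (fun i => n ≤ X * i)]
    have hlargeSum : ∑ i ∈ S with n ≤ X * i, w i a ≤ 1 / 2 := by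
      have e1 : ∑ i ∈ S with n ≤ X * i, w i a =
          (∑ t ∈ (S.filter fun i => n ≤ X * i).image (fun i => a / i), (t : ℝ)⁻¹) / Λ := by
        rw [Finset.sum_image (hinj.mono fun i hi => (Finset.mem_filter.1 hi).1), Finset.sum_div]
        refine Finset.sum_congr rfl fun i hi => ?_
        simp only [w, (Finset.mem_filter.1 hi).2, if_true]
      rw [e1, div_le_iff₀ hΛ0]
      have := sum_inv_le_one_add_log
        (U := (S.filter fun i => n ≤ X * i).image (fun i => a / i)) hX ?_ ?_
      · linarith
      · intro t ht
        obtain ⟨i, hi, rfl⟩ := Finset.mem_image.1 ht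
        obtain ⟨hi0, hin, -, hna, -, -⟩ := hSA i (Finset.mem_filter.1 hi).1
        exact Nat.div_pos (by omega) hi0
      · intro t ht u hu
        obtain ⟨i, hi, rfl⟩ := Finset.mem_image.1 ht
        obtain ⟨j, hj, rfl⟩ := Finset.mem_image.1 hu
        obtain ⟨hi0, hin, ⟨s, hs⟩, -⟩ := hSA i (Finset.mem_filter.1 hi).1
        have hj0 := (hSA j (Finset.mem_filter.1 hj).1).1
        have hjX := (Finset.mem_filter.1 hj).2
        have hq : a / i = s := by rw [hs, Nat.mul_div_cancel_left s hi0]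
        simp only [hq]
        refine Nat.div_le_of_le_mul ?_
        calc a = i * s := hs
          _ ≤ (X * j) * s := Nat.mul_le_mul_right s (hin.trans hjX)
          _ = j * (X * s) := by ring
    have hsmallSum : ∑ i ∈ S with ¬ n ≤ X * i, w i a ≤ 1 / 2 := by
      rcases (S.filter fun i => ¬ n ≤ X * i).eq_empty_or_nonempty with he | ⟨i₀, hi₀⟩
      · rw [he]
        norm_num
      have e1 : ∑ i ∈ S with ¬ n ≤ X * i, w i a =
          ((S.filter fun i => ¬ n ≤ X * i).card : ℝ) * D⁻¹ := by
        rw [← nsmul_eq_mul, ← Finset.sum_const]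
        refine Finset.sum_congr rfl fun i hi => ?_
        simp only [w, (Finset.mem_filter.1 hi).2, if_false]
      obtain ⟨-, -, -, hna, haT, -⟩ := hSA i₀ (Finset.mem_filter.1 hi₀).1
      have ha0 : a ≠ 0 := by omega
      have hcard : (S.filter fun i => ¬ n ≤ X * i).card ≤ a.primeFactors.card := by
        refine Finset.card_le_card_of_injOn (fun i => a / i) ?_
          (hinj.mono fun i hi => (Finset.mem_filter.1 hi).1)
        intro i hi
        have hi := Finset.mem_filter.1 hi
        obtain ⟨hi0, -, hia, -, -, hiC⟩ := hSA i hi.1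
        simp only [C, hi.2, if_false] at hiC
        exact Nat.mem_primeFactors.2
          ⟨(Finset.mem_filter.1 hiC).2, Nat.div_dvd_of_dvd hia, ha0⟩
      have hlogn : log (a : ℝ) ≤ 2 * log n := by
        have hann : (a : ℝ) ≤ n * n := by
          exact_mod_cast haT.trans (Nat.mul_le_mul_right n hTn)
        have hn' : (n : ℝ) ≠ 0 := by exact_mod_cast hn.ne'
        have := log_le_log (by exact_mod_cast Nat.pos_of_ne_zero ha0) hann
        rw [log_mul hn' hn'] at this
        linarith
      have hc := card_primeFactors_le_two_mul_log ha0
      have hcard' : ((S.filter fun i => ¬ n ≤ X * i).card : ℝ) ≤ a.primeFactors.card := by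
        exact_mod_cast hcard
      rw [e1, ← div_eq_mul_inv, div_le_iff₀ hD0]
      linarith
    linarith
  obtain ⟨g, hg, hgA⟩ := exists_injOn_of_fractional_matching (Finset.Icc 1 n) A w hw h1 h2
  refine f_le_of_injOn (a := g) (fun i hi => ?_) (fun i hi => ?_) hg
  · exact (hA i (Finset.mem_Icc.1 hi).1 _ (hgA i hi)).1
  · obtain ⟨-, h3, h4, -⟩ := hA i (Finset.mem_Icc.1 hi).1 _ (hgA i hi)
    exact ⟨h3, by omega⟩

open Filter in
lemma eventually_f_self_le : ∀ᶠ M : ℕ in atTop, ∀ n : ℕ, (M : ℝ) ^ 10 ≤ log n →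
    log n < ((M : ℝ) + 1) ^ 10 → f n n ≤ M ^ 9 * n := by
  have hpow : Tendsto (fun M : ℕ => (M : ℝ) ^ 12) atTop atTop :=
    (tendsto_pow_atTop (by norm_num)).comp tendsto_natCast_atTop_atTop
  obtain ⟨Y, hY⟩ := eventually_atTop.1 eventually_rpow_le_card_primes
  filter_upwards [hpow.eventually_ge_atTop Y, eventually_ge_atTop 8192] with M hMY hM n hlo hhi
  have hM' : (8192 : ℝ) ≤ M := by exact_mod_cast hM
  have hM0 : (0 : ℝ) < M := by linarith
  have hn : 0 < n := by
    rcases Nat.eq_zero_or_pos n with rfl | h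
    · simp only [Nat.cast_zero, log_zero] at hlo
      exact absurd hlo (not_le.2 (by positivity))
    · exact h
  have hn' : (0 : ℝ) < n := by exact_mod_cast hn
  have hlogM : 1 ≤ log M := by
    rw [le_log_iff_exp_le hM0]
    linarith [exp_one_lt_d9]
  refine f_self_le_mul (X := M ^ 3) (D := (M : ℝ) ^ 11) hn (by positivity) ?_ ?_ ?_ ?_
    (by positivity) ?_
  · have h1 : (M : ℝ) ^ 9 ≤ M ^ 10 := pow_le_pow_right₀ (by linarith) (by norm_num)
    have h2 := log_le_sub_one_of_pos hn'
    have h3 : (M : ℝ) ^ 9 ≤ n := by linarith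
    exact_mod_cast h3
  · calc 2 < M := by omega
      _ = M ^ 1 := (pow_one M).symm
      _ ≤ M ^ 9 := Nat.pow_le_pow_right (by omega) (by norm_num)
  · push_cast
    rw [log_div (by positivity) (by norm_num), log_pow, log_pow]
    push_cast
    linarith [log_two_lt_d9]
  · have h1 : ((M : ℝ) + 1) ^ 10 ≤ (2 * M) ^ 10 :=
      pow_le_pow_left₀ (by linarith) (by linarith) 10
    have h2 : (2 * (M : ℝ)) ^ 10 = 1024 * M ^ 10 := by ring
    have h3 : (8192 : ℝ) * M ^ 10 ≤ M * M ^ 10 :=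
      mul_le_mul_of_nonneg_right hM' (by positivity)
    have h4 : (M : ℝ) ^ 11 = M * M ^ 10 := by ring
    linarith
  · intro i hi hin
    have hi' : (0 : ℝ) < i := by exact_mod_cast hi
    have hin' : (M : ℝ) ^ 3 * i < n := by exact_mod_cast hin
    have hz : (M : ℝ) ^ 3 ≤ n / i := by
      rw [le_div_iff₀ hi']
      exact hin'.le
    have hM9 : (6 : ℝ) ≤ M ^ 9 := by
      calc (6 : ℝ) ≤ M := by linarith
        _ = M ^ 1 := (pow_one _).symm
        _ ≤ M ^ 9 := pow_le_pow_right₀ (by linarith) (by norm_num)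
    have hy : ((M ^ 9 * n : ℕ) : ℝ) / i = M ^ 9 * (n / i) := by push_cast; ring
    have h12 : (M : ℝ) ^ 12 ≤ ((M ^ 9 * n : ℕ) : ℝ) / i := by
      rw [hy, show (M : ℝ) ^ 12 = M ^ 9 * M ^ 3 by ring]
      exact mul_le_mul_of_nonneg_left hz (by positivity)
    have h6 : 6 * ((n : ℝ) / i) ≤ ((M ^ 9 * n : ℕ) : ℝ) / i := by
      rw [hy]
      exact mul_le_mul_of_nonneg_right hM9 (by positivity)
    have key := hY _ (hMY.trans h12) (n / i) (by positivity) h6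
    rw [Nat.floor_div_eq_div, Nat.floor_div_eq_div] at key
    refine le_trans ?_ key
    calc (M : ℝ) ^ 11 = ((M : ℝ) ^ 12) ^ (11 / 12 : ℝ) := by
          rw [← rpow_natCast (M : ℝ) 12, ← rpow_mul hM0.le, ← rpow_natCast]
          norm_num
      _ ≤ _ := rpow_le_rpow (by positivity) h12 (by norm_num)

theorem stmt_6 : ∃ N : ℕ, ∀ n : ℕ, N ≤ n → 0 < n →
    ∀ k : ℕ, k = ⌈0.6 * Real.sqrt (Real.log n / Real.log (Real.log n))⌉₊ →
      (1 / 100 : ℝ) * k ^ 2 * n > (f n n : ℝ) := by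
  have hloglog : ∀ᶠ M : ℕ in Filter.atTop, 10 * log ((M : ℝ) + 1) < 0.0036 * M := by
    have h := (isLittleO_log_id_atTop.bound (by norm_num : (0 : ℝ) < 0.0001))
    have ht : Filter.Tendsto (fun M : ℕ => (M : ℝ) + 1) Filter.atTop Filter.atTop :=
      Filter.tendsto_atTop_add_const_right _ _ tendsto_natCast_atTop_atTop
    filter_upwards [ht.eventually h, Filter.eventually_ge_atTop 1] with M hM hM1
    have hM1' : (1 : ℝ) ≤ M := by exact_mod_cast hM1
    rw [id, norm_of_nonneg (log_nonneg (by linarith)), norm_of_nonneg (by linarith)] at hM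
    linarith
  have hMtendsto : Filter.Tendsto (fun n : ℕ => ⌊(log n) ^ (1 / 10 : ℝ)⌋₊)
      Filter.atTop Filter.atTop :=
    tendsto_nat_floor_atTop.comp ((tendsto_rpow_atTop (by norm_num)).comp
      (tendsto_log_atTop.comp tendsto_natCast_atTop_atTop))
  have hlogt : Filter.Tendsto (fun n : ℕ => log (n : ℝ)) Filter.atTop Filter.atTop :=
    tendsto_log_atTop.comp tendsto_natCast_atTop_atTop
  obtain ⟨N, hN⟩ := Filter.eventually_atTop.1 ((hMtendsto.eventually eventually_f_self_le).and
    ((hMtendsto.eventually hloglog).and ((hMtendsto.eventually_ge_atTop 1).and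
      (hlogt.eventually_gt_atTop 1))))
  refine ⟨N, fun n hn hn0 k hk => ?_⟩
  obtain ⟨hf, hll, hM1, hlog1⟩ := hN n hn
  set M := ⌊(log n) ^ (1 / 10 : ℝ)⌋₊
  have hlog0 : 0 ≤ log (n : ℝ) := by linarith
  have hroot : ((log (n : ℝ)) ^ (1 / 10 : ℝ)) ^ 10 = log n := by
    rw [← rpow_natCast, ← rpow_mul hlog0]
    norm_num
  have hlo : (M : ℝ) ^ 10 ≤ log n := by
    rw [← hroot]
    exact pow_le_pow_left₀ (Nat.cast_nonneg _) (Nat.floor_le (by positivity)) 10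
  have hhi : log n < ((M : ℝ) + 1) ^ 10 := by
    rw [← hroot]
    exact pow_lt_pow_left₀ (Nat.lt_floor_add_one _) (by positivity) (by norm_num)
  have hf' : (f n n : ℝ) ≤ (M : ℝ) ^ 9 * n := by exact_mod_cast hf n hlo hhi
  have hM0 : (0 : ℝ) < M := by exact_mod_cast hM1
  have hn' : (0 : ℝ) < n := by exact_mod_cast hn0
  have hll0 : 0 < log (log n) := log_pos hlog1
  have hll1 : log (log n) < 0.0036 * M := by
    have := log_le_log (by linarith) hhi.le
    rw [log_pow] at this
    push_cast at this
    linarith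
  have hk1 : 0.6 * √(log n / log (log n)) ≤ k := hk ▸ Nat.le_ceil _
  have hk2 : 0.36 * (log n / log (log n)) ≤ (k : ℝ) ^ 2 := by
    have := pow_le_pow_left₀ (by positivity) hk1 2
    rw [mul_pow, sq_sqrt (div_nonneg hlog0 hll0.le)] at this
    linarith
  have hk3 : (M : ℝ) ^ 9 < 0.0036 * (log n / log (log n)) := by
    rw [← mul_div_assoc, lt_div_iff₀ hll0]
    calc (M : ℝ) ^ 9 * log (log n) < M ^ 9 * (0.0036 * M) :=
          mul_lt_mul_of_pos_left hll1 (by positivity)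
      _ = 0.0036 * M ^ 10 := by ring
      _ ≤ 0.0036 * log n := by linarith
  calc (f n n : ℝ) ≤ (M : ℝ) ^ 9 * n := hf'
    _ < (1 / 100 : ℝ) * k ^ 2 * n := mul_lt_mul_of_pos_right (by linarith) hn'
end
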